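/- The factorization number of ZM(9,4,8) equals 85. -/

import Mathlib

open Pointwise

/-- The relators of the Zassenhaus metacyclic group
`ZM(m,n,r) = ⟨a, b | a^m = b^n = 1, b⁻¹ab = a^r⟩`. -/
def ZMrel (m n r : ℕ) : Set (FreeGroup (Fin 2)) :=
  {FreeGroup.of 0 ^ m, FreeGroup.of 1 ^ n,
   (FreeGroup.of 1)⁻¹ * FreeGroup.of 0 * FreeGroup.of 1 * (FreeGroup.of 0 ^ r)⁻¹}

/-- The ZM-group `ZM(m,n,r)` as a presented group. -/
abbrev ZM (m n r : ℕ) : Type := PresentedGroup (ZMrel m n r)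

/-- The generator `a` of `ZM(m,n,r)`. -/
def za (m n r : ℕ) : ZM m n r := PresentedGroup.of 0

/-- The generator `b` of `ZM(m,n,r)`. -/
def zb (m n r : ℕ) : ZM m n r := PresentedGroup.of 1

namespace QuaternionGroup

variable {n : ℕ}

/-- The universal property of the presentation `⟨c, x | c²ⁿ = 1, x² = cⁿ, xc = c⁻¹x⟩` of the
quaternion group. -/
def lift {G : Type*} [Group G] (c x : G) (hc : c ^ (2 * n) = 1) (hx : x * x = c ^ n)
    (hxc : x * c = c⁻¹ * x) : QuaternionGroup n →* G :=
  let φ : ZMod (2 * n) →+ Additive G :=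
    ZMod.lift (2 * n) ⟨zmultiplesHom (Additive G) (Additive.ofMul c), by
      rw [zmultiplesHom_apply, natCast_zsmul, ← ofMul_pow, hc, ofMul_one]⟩
  have hφ (z : ℤ) : (φ z).toMul = c ^ z := by simp [φ, ZMod.lift_coe]
  have comm (i : ZMod (2 * n)) : (φ i).toMul * x = x * (φ (-i)).toMul := by
    obtain ⟨z, rfl⟩ := ZMod.intCast_surjective i
    rw [← Int.cast_neg, hφ, hφ]
    have h : SemiconjBy x c c⁻¹ := hxc
    simpa [SemiconjBy] using (h.zpow_right (-z)).symm
  { toFun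
      | a i => (φ i).toMul
      | xa i => x * (φ i).toMul
    map_one' := by
      change (φ 0).toMul = 1
      simp
    map_mul' := by
      have hn : (φ n).toMul = x * x := by
        rw [hx, ← Int.cast_natCast, hφ, zpow_natCast]
      rintro (i | i) (j | j)
      · simp
      · simp only [a_mul_xa]
        rw [← mul_assoc, comm, mul_assoc, ← toMul_add, ← map_add, neg_add_eq_sub]
      · simp [mul_assoc]
      · simp only [xa_mul_xa]
        rw [mul_assoc x, ← mul_assoc _ x, comm, mul_assoc x, ← mul_assoc x x, ← hn, ← toMul_add,
          ← toMul_add, ← map_add, ← map_add]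
        congr 2
        abel }

@[simp]
theorem lift_a_natCast {G : Type*} [Group G] (c x : G) (hc : c ^ (2 * n) = 1)
    (hx : x * x = c ^ n) (hxc : x * c = c⁻¹ * x) (k : ℕ) : lift c x hc hx hxc (a k) = c ^ k := by
  change Additive.toMul (ZMod.lift (2 * n) _ (k : ZMod (2 * n)) : Additive G) = _
  have hk : (k : ZMod (2 * n)) = ((k : ℤ) : ZMod (2 * n)) := (Int.cast_natCast k).symm
  rw [hk, ZMod.lift_coe]
  simp

@[simp]
theorem lift_xa_zero {G : Type*} [Group G] (c x : G) (hc : c ^ (2 * n) = 1)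
    (hx : x * x = c ^ n) (hxc : x * c = c⁻¹ * x) : lift c x hc hx hxc (xa 0) = x := by
  change x * Additive.toMul (ZMod.lift (2 * n) _ (0 : ZMod (2 * n)) : Additive G) = _
  simp

theorem hom_ext {G : Type*} [Group G] {f g : QuaternionGroup n →* G} (ha : f (a 1) = g (a 1))
    (hx : f (xa 0) = g (xa 0)) : f = g := by
  have key (i : ZMod (2 * n)) : f (a i) = g (a i) := by
    obtain ⟨z, rfl⟩ := ZMod.intCast_surjective i
    have hz : (a (z : ZMod (2 * n))) = a 1 ^ z := by
      cases z with
      | ofNat k => simp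
      | negSucc k =>
        rw [zpow_negSucc, a_one_pow]
        simp only [Int.cast_negSucc]
        rfl
    rw [hz, map_zpow, map_zpow, ha]
  ext (i | i)
  · exact key i
  · have : xa i = xa 0 * a i := by simp
    rw [this, map_mul, map_mul, hx, key]

/-- The subgroup of rotations `a i` with `i ∈ K`. -/
def rotations (K : AddSubgroup (ZMod (2 * n))) : Subgroup (QuaternionGroup n) where
  carrier := {g | match g with
    | a i => i ∈ K
    | xa _ => False}
  one_mem' := K.zero_mem
  mul_mem' := by
    rintro (i | i) (j | j) hi hj
    · exact K.add_mem hi hj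
    all_goals simp_all
  inv_mem' := by
    rintro (i | i) hi
    · exact K.neg_mem hi
    · exact hi

/-- The subgroup of all `a i` with `i ∈ K` and `xa i` with `i ∈ s + K`. -/
def dicyclic (K : AddSubgroup (ZMod (2 * n))) (hK : (n : ZMod (2 * n)) ∈ K) (s : ZMod (2 * n)) :
    Subgroup (QuaternionGroup n) where
  carrier := {g | match g with
    | a i => i ∈ K
    | xa i => i - s ∈ K}
  one_mem' := K.zero_mem
  mul_mem' := by
    rintro (i | i) (j | j) hi hj
    · exact K.add_mem hi hj
    · change j - i - s ∈ K
      rw [sub_right_comm]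
      exact K.sub_mem hj hi
    · change i + j - s ∈ K
      rw [add_sub_right_comm]
      exact K.add_mem hi hj
    · change (n : ZMod (2 * n)) + j - i ∈ K
      have := K.add_mem hK (K.sub_mem hj hi)
      rwa [sub_sub_sub_cancel_right, ← add_sub_assoc] at this
  inv_mem' := by
    rintro (i | i) hi
    · exact K.neg_mem hi
    · change (n : ZMod (2 * n)) + i - s ∈ K
      rw [add_sub_assoc]
      exact K.add_mem hK hi

section Membership

variable {K : AddSubgroup (ZMod (2 * n))} {hK : (n : ZMod (2 * n)) ∈ K} {s i : ZMod (2 * n)}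

@[simp] theorem a_mem_rotations : a i ∈ rotations K ↔ i ∈ K := Iff.rfl

@[simp] theorem xa_notMem_rotations : xa i ∉ rotations K := id

@[simp] theorem a_mem_dicyclic : a i ∈ dicyclic K hK s ↔ i ∈ K := Iff.rfl

@[simp] theorem xa_mem_dicyclic : xa i ∈ dicyclic K hK s ↔ i - s ∈ K := Iff.rfl

end Membership

theorem eq_rotations_or_eq_dicyclic (H : Subgroup (QuaternionGroup n)) :
    (∃ K, H = rotations K) ∨ ∃ K hK s, H = dicyclic K hK s := by
  let K : AddSubgroup (ZMod (2 * n)) :=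
    { carrier := {i | a i ∈ H}
      zero_mem' := H.one_mem
      add_mem' := fun hi hj => H.mul_mem hi hj
      neg_mem' := fun hi => H.inv_mem hi }
  have memK (i) : i ∈ K ↔ a i ∈ H := Iff.rfl
  by_cases h : ∃ s, xa s ∈ H
  · obtain ⟨s, hs⟩ := h
    have hn : (n : ZMod (2 * n)) ∈ K := by
      rw [memK]
      simpa using H.mul_mem hs hs
    refine Or.inr ⟨K, hn, s, ?_⟩
    ext (i | i)
    · rfl
    · rw [xa_mem_dicyclic, memK]
      have : xa i = xa s * a (i - s) := by simp
      rw [this, H.mul_mem_cancel_left hs]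
  · refine Or.inl ⟨K, ?_⟩
    ext (i | i)
    · rfl
    · simpa using fun hi => h ⟨i, hi⟩

section Factorization

variable {K L : AddSubgroup (ZMod (2 * n))} {hK : (n : ZMod (2 * n)) ∈ K}
  {hL : (n : ZMod (2 * n)) ∈ L} {s t : ZMod (2 * n)}

theorem rotations_mul_rotations_ne :
    (rotations K : Set (QuaternionGroup n)) * (rotations L : Set (QuaternionGroup n))
      ≠ Set.univ := by
  intro h
  obtain ⟨i | i, hi, j | j, hj, hij⟩ := h.ge (Set.mem_univ (xa 0))
  · simp at hij
  · exact hj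
  all_goals exact hi

theorem rotations_mul_dicyclic_eq_univ_iff :
    (rotations K : Set (QuaternionGroup n)) * (dicyclic L hL t : Set (QuaternionGroup n))
      = Set.univ ↔ K ⊔ L = ⊤ := by
  rw [Set.eq_univ_iff_forall, AddSubgroup.eq_top_iff']
  simp only [AddSubgroup.mem_sup, Set.mem_mul, SetLike.mem_coe]
  constructor
  · intro h i
    obtain ⟨j | j, hj, k | k, hk, hjk⟩ := h (a i)
    · exact ⟨j, hj, k, hk, a.inj hjk⟩
    · simp at hjk
    all_goals exact hj.elim
  · rintro h (i | i)
    · obtain ⟨j, hj, k, hk, rfl⟩ := h i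
      exact ⟨a j, hj, a k, hk, rfl⟩
    · obtain ⟨j, hj, k, hk, hjk⟩ := h (i - t)
      refine ⟨a (-j), K.neg_mem hj, xa (k + t), by simpa, ?_⟩
      rw [a_mul_xa, eq_add_of_sub_eq hjk.symm]
      congr 1
      abel

theorem dicyclic_mul_rotations_eq_univ_iff :
    (dicyclic K hK s : Set (QuaternionGroup n)) * (rotations L : Set (QuaternionGroup n))
      = Set.univ ↔ K ⊔ L = ⊤ := by
  rw [← inv_inj (a := (_ : Set (QuaternionGroup n))), mul_inv_rev, Set.inv_univ]
  simp only [inv_coe_set]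
  rw [rotations_mul_dicyclic_eq_univ_iff, sup_comm]

theorem dicyclic_mul_dicyclic_eq_univ_iff (hn : Odd n) :
    (dicyclic K hK s : Set (QuaternionGroup n)) * (dicyclic L hL t : Set (QuaternionGroup n))
      = Set.univ ↔ K ⊔ L = ⊤ := by
  constructor
  · intro h
    have hKM : K ≤ K ⊔ L := le_sup_left
    have hLM : L ≤ K ⊔ L := le_sup_right
    have key (i : ZMod (2 * n)) : i ∈ K ⊔ L ∨ i - (t - s) ∈ K ⊔ L := by
      obtain ⟨j | j, hj, k | k, hk, hjk⟩ := h.ge (Set.mem_univ (a i))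
      · left
        rw [← a.inj hjk]
        exact add_mem (hKM hj) (hLM hk)
      · simp at hjk
      · simp at hjk
      · right
        rw [← a.inj hjk]
        have := sub_mem (add_mem (hKM hK) (hLM hk)) (hKM hj)
        convert this using 1
        abel
    have hts : t - s ∈ K ⊔ L := by
      obtain ⟨m, hm⟩ := hn
      rcases key (t - s + (t - s)) with h2 | h2
      · have hnts : n • (t - s) ∈ K ⊔ L := by
          have := zsmul_mem (hKM hK) ((t - s).cast : ℤ)
          rw [zsmul_eq_mul, ZMod.intCast_cast, ZMod.cast_id] at this
          rwa [nsmul_eq_mul, mul_comm (n : ZMod (2 * n))]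
        have hsub : n • (t - s) - m • (t - s + (t - s)) = t - s := by
          have : n • (t - s) = (2 * m + 1) • (t - s) := congrArg (· • (t - s)) hm
          rw [this]
          module
        exact hsub ▸ sub_mem hnts (nsmul_mem h2 m)
      · simpa using h2
    refine (AddSubgroup.eq_top_iff' _).2 fun i => (key i).elim id fun hi => ?_
    simpa using add_mem hi hts
  · intro h
    rw [← rotations_mul_dicyclic_eq_univ_iff (hL := hL) (t := t)] at h
    refine Set.eq_univ_of_univ_subset (h.ge.trans (Set.mul_subset_mul_right ?_))
    rintro (i | i) hi
    · exact hi
    · exact hi.elim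

end Factorization

end QuaternionGroup

namespace ZMod

/-- The residues modulo `N` that are divisible by the divisor `d` of `N`. -/
def multiples {N d : ℕ} (hd : d ∣ N) : AddSubgroup (ZMod N) :=
  (castHom hd (ZMod d)).toAddMonoidHom.ker

variable {N d e : ℕ}

theorem mem_multiples {hd : d ∣ N} {i : ZMod N} :
    i ∈ multiples hd ↔ castHom hd (ZMod d) i = 0 := Iff.rfl

theorem intCast_mem_multiples {hd : d ∣ N} {z : ℤ} :
    (z : ZMod N) ∈ multiples hd ↔ (d : ℤ) ∣ z := by
  rw [mem_multiples, map_intCast, intCast_zmod_eq_zero_iff_dvd]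

theorem natCast_mem_multiples {hd : d ∣ N} {k : ℕ} : (k : ZMod N) ∈ multiples hd ↔ d ∣ k := by
  rw [mem_multiples, map_natCast, natCast_eq_zero_iff]

theorem multiples_le_iff {hd : d ∣ N} {he : e ∣ N} : multiples hd ≤ multiples he ↔ e ∣ d := by
  refine ⟨fun h => natCast_mem_multiples.1 (h (natCast_mem_multiples.2 dvd_rfl)), fun h i hi => ?_⟩
  obtain ⟨z, rfl⟩ := intCast_surjective i
  rw [intCast_mem_multiples] at hi ⊢
  exact (Int.natCast_dvd_natCast.2 h).trans hi

theorem eq_of_multiples_eq {hd : d ∣ N} {he : e ∣ N} (h : multiples hd = multiples he) : d = e :=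
  Nat.dvd_antisymm (multiples_le_iff.1 h.ge) (multiples_le_iff.1 h.le)

theorem exists_eq_multiples (K : AddSubgroup (ZMod N)) : ∃ d, ∃ hd : d ∣ N, K = multiples hd := by
  obtain ⟨g, hg⟩ := Int.subgroup_cyclic (K.comap (Int.castAddHom (ZMod N)))
  have key (z : ℤ) : (z : ZMod N) ∈ K ↔ (g.natAbs : ℤ) ∣ z := by
    rw [Int.natAbs_dvd, ← Int.mem_zmultiples_iff, AddSubgroup.zmultiples_eq_closure, ← hg]
    rfl
  refine ⟨g.natAbs, Int.natCast_dvd_natCast.1 ((key N).1 (by simp)), ?_⟩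
  ext i
  obtain ⟨z, rfl⟩ := intCast_surjective i
  rw [key, intCast_mem_multiples]

theorem multiples_sup_multiples_eq_top_iff {hd : d ∣ N} {he : e ∣ N} :
    multiples hd ⊔ multiples he = ⊤ ↔ d.Coprime e := by
  constructor
  · intro h
    have hg : d.gcd e ∣ N := (Nat.gcd_dvd_left d e).trans hd
    have hle : multiples hd ⊔ multiples he ≤ multiples hg :=
      sup_le (multiples_le_iff.2 (Nat.gcd_dvd_left d e)) (multiples_le_iff.2 (Nat.gcd_dvd_right d e))
    have h1 : ((1 : ℕ) : ZMod N) ∈ multiples hg := hle (h ▸ AddSubgroup.mem_top _)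
    exact Nat.dvd_one.1 (natCast_mem_multiples.1 h1)
  · intro h
    rw [AddSubgroup.eq_top_iff']
    intro i
    obtain ⟨z, rfl⟩ := intCast_surjective i
    obtain ⟨u, v, huv⟩ := (Nat.isCoprime_iff_coprime.2 h)
    rw [← one_mul z, ← huv, add_mul, Int.cast_add]
    refine AddSubgroup.add_mem_sup (intCast_mem_multiples.2 ?_) (intCast_mem_multiples.2 ?_)
    · exact (Dvd.intro_left u rfl).mul_right z
    · exact (Dvd.intro_left v rfl).mul_right z

end ZMod

namespace QuaternionGroup

variable {n : ℕ}

/-- An index type for the subgroups of `QuaternionGroup n`: a divisor of `2n` for each subgroup of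
rotations, a divisor `d` of `n` and a residue modulo `d` for every other subgroup. -/
abbrev SubgroupIndex (n : ℕ) : Type :=
  {d // d ∈ (2 * n).divisors} ⊕ Σ d : {d // d ∈ n.divisors}, ZMod d

instance (d : {d // d ∈ n.divisors}) : NeZero (d : ℕ) :=
  ⟨(Nat.pos_of_mem_divisors d.2).ne'⟩

theorem dvd_two_mul_of_mem_divisors {d : ℕ} (hd : d ∈ n.divisors) : d ∣ 2 * n :=
  (Nat.dvd_of_mem_divisors hd).mul_left 2

/-- The subgroup of `QuaternionGroup n` with the given index. -/
def ofIndex : SubgroupIndex n → Subgroup (QuaternionGroup n)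
  | .inl d => rotations (ZMod.multiples (Nat.dvd_of_mem_divisors d.2))
  | .inr ⟨d, s⟩ => dicyclic (ZMod.multiples (dvd_two_mul_of_mem_divisors d.2))
      (ZMod.natCast_mem_multiples.2 (Nat.dvd_of_mem_divisors d.2)) (s.val : ℕ)

theorem rotations_ne_dicyclic {K L : AddSubgroup (ZMod (2 * n))} (hL : (n : ZMod (2 * n)) ∈ L)
    (s : ZMod (2 * n)) : rotations K ≠ dicyclic L hL s := by
  intro h
  have : xa s ∈ dicyclic L hL s := by simp
  rw [← h] at this
  exact this

theorem ofIndex_injective : Function.Injective (ofIndex (n := n)) := by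
  rintro (⟨d, hd⟩ | ⟨⟨d, hd⟩, s⟩) (⟨e, he⟩ | ⟨⟨e, he⟩, t⟩) h
  · obtain rfl : d = e := ZMod.eq_of_multiples_eq <| by
      exact AddSubgroup.ext fun i => SetLike.ext_iff.1 h (a i)
    rfl
  · exact (rotations_ne_dicyclic
      (ZMod.natCast_mem_multiples.2 (Nat.dvd_of_mem_divisors he)) _ h).elim
  · exact (rotations_ne_dicyclic
      (ZMod.natCast_mem_multiples.2 (Nat.dvd_of_mem_divisors hd)) _ h.symm).elim
  · obtain rfl : d = e := ZMod.eq_of_multiples_eq <| by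
      exact AddSubgroup.ext fun i => SetLike.ext_iff.1 h (a i)
    have : NeZero d := ⟨(Nat.pos_of_mem_divisors hd).ne'⟩
    have hs := (SetLike.ext_iff.1 h (xa (s.val : ℕ))).1 (by simp [ofIndex])
    simp only [ofIndex, xa_mem_dicyclic, ZMod.mem_multiples, map_sub, map_natCast,
      ZMod.natCast_zmod_val, sub_eq_zero] at hs
    rw [hs]

theorem ofIndex_surjective (hn : n ≠ 0) : Function.Surjective (ofIndex (n := n)) := by
  intro H
  rcases eq_rotations_or_eq_dicyclic H with ⟨K, rfl⟩ | ⟨K, hK, s, rfl⟩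
  · obtain ⟨d, hd, rfl⟩ := ZMod.exists_eq_multiples K
    exact ⟨.inl ⟨d, Nat.mem_divisors.2 ⟨hd, by simp [hn]⟩⟩, rfl⟩
  · obtain ⟨d, hd, rfl⟩ := ZMod.exists_eq_multiples K
    have hdn : d ∈ n.divisors := Nat.mem_divisors.2 ⟨ZMod.natCast_mem_multiples.1 hK, hn⟩
    have : NeZero d := ⟨(Nat.pos_of_mem_divisors hdn).ne'⟩
    refine ⟨.inr ⟨⟨d, hdn⟩, ZMod.castHom hd (ZMod d) s⟩, ?_⟩
    ext (i | i)
    · rfl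
    · simp only [ofIndex, xa_mem_dicyclic, ZMod.mem_multiples, map_sub, map_natCast,
        ZMod.natCast_zmod_val]

/-- Whether the subgroups with the given indices have the whole group as their product, for odd
`n`. -/
def IsFactorization : SubgroupIndex n → SubgroupIndex n → Prop
  | .inl _, .inl _ => False
  | .inl d, .inr ⟨e, _⟩ => (d : ℕ).Coprime e
  | .inr ⟨d, _⟩, .inl e => (d : ℕ).Coprime e
  | .inr ⟨d, _⟩, .inr ⟨e, _⟩ => (d : ℕ).Coprime e

instance : DecidableRel (IsFactorization (n := n))
  | .inl _, .inl _ => inferInstanceAs (Decidable False)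
  | .inl d, .inr ⟨e, _⟩ => inferInstanceAs (Decidable ((d : ℕ).Coprime e))
  | .inr ⟨d, _⟩, .inl e => inferInstanceAs (Decidable ((d : ℕ).Coprime e))
  | .inr ⟨d, _⟩, .inr ⟨e, _⟩ => inferInstanceAs (Decidable ((d : ℕ).Coprime e))

theorem ofIndex_mul_ofIndex_eq_univ_iff (hn : Odd n) (p q : SubgroupIndex n) :
    (ofIndex p : Set (QuaternionGroup n)) * (ofIndex q : Set (QuaternionGroup n)) = Set.univ ↔
      IsFactorization p q := by
  rcases p with d | ⟨d, s⟩ <;> rcases q with e | ⟨e, t⟩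
  · exact iff_of_false rotations_mul_rotations_ne id
  all_goals simp only [ofIndex]
  · rw [rotations_mul_dicyclic_eq_univ_iff, ZMod.multiples_sup_multiples_eq_top_iff]
    rfl
  · rw [dicyclic_mul_rotations_eq_univ_iff, ZMod.multiples_sup_multiples_eq_top_iff]
    rfl
  · rw [dicyclic_mul_dicyclic_eq_univ_iff hn, ZMod.multiples_sup_multiples_eq_top_iff]
    rfl

theorem card_factorizations (hn : Odd n) :
    Nat.card {p : Subgroup (QuaternionGroup n) × Subgroup (QuaternionGroup n) //
        (p.1 : Set (QuaternionGroup n)) * (p.2 : Set (QuaternionGroup n)) = Set.univ} =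
      Fintype.card {p : SubgroupIndex n × SubgroupIndex n // IsFactorization p.1 p.2} := by
  rw [← Nat.card_eq_fintype_card]
  let E := Equiv.ofBijective _ ⟨ofIndex_injective, ofIndex_surjective hn.pos.ne'⟩
  exact (Nat.card_congr ((E.prodCongr E).subtypeEquiv fun p =>
    (ofIndex_mul_ofIndex_eq_univ_iff hn p.1 p.2).symm)).symm

end QuaternionGroup

theorem card_factorizations_congr {G G' : Type*} [Group G] [Group G'] (e : G ≃* G') :
    Nat.card {p : Subgroup G × Subgroup G // (p.1 : Set G) * (p.2 : Set G) = Set.univ} =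
      Nat.card {p : Subgroup G' × Subgroup G' // (p.1 : Set G') * (p.2 : Set G') = Set.univ} := by
  let E := e.mapSubgroup.toEquiv
  refine Nat.card_congr ((E.prodCongr E).subtypeEquiv fun p => ?_)
  change _ ↔ Set.image e (p.1 : Set G) * Set.image e (p.2 : Set G) = Set.univ
  rw [← Set.image_mul, ← Set.image_univ_of_surjective e.surjective,
    e.injective.image_injective.eq_iff]

theorem za_pow (m n r : ℕ) : za m n r ^ m = 1 :=
  PresentedGroup.one_of_mem (rels := ZMrel m n r) (x := FreeGroup.of 0 ^ m) (by simp [ZMrel])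

theorem zb_pow (m n r : ℕ) : zb m n r ^ n = 1 :=
  PresentedGroup.one_of_mem (rels := ZMrel m n r) (x := FreeGroup.of 1 ^ n) (by simp [ZMrel])

theorem za_mul_zb (m n r : ℕ) : za m n r * zb m n r = zb m n r * za m n r ^ r := by
  have h : (zb m n r)⁻¹ * za m n r * zb m n r * (za m n r ^ r)⁻¹ = 1 :=
    PresentedGroup.one_of_mem (rels := ZMrel m n r)
      (x := (FreeGroup.of 1)⁻¹ * FreeGroup.of 0 * FreeGroup.of 1 * (FreeGroup.of 0 ^ r)⁻¹)
      (by simp [ZMrel])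
  rw [mul_inv_eq_one, mul_assoc, inv_mul_eq_iff_eq_mul] at h
  exact h

/-- The isomorphism of `ZM(9,4,8)` with the quaternion group of order `36`. -/
noncomputable def ZM948EquivQuaternionGroup : ZM 9 4 8 ≃* QuaternionGroup 9 := by
  let f : ZM 9 4 8 →* QuaternionGroup 9 :=
    PresentedGroup.toGroup (f := ![.a 2, .xa 0]) (by
      rintro r (rfl | rfl | rfl) <;> simp <;> decide)
  have fa : f (za 9 4 8) = .a 2 := PresentedGroup.toGroup.of _
  have fb : f (zb 9 4 8) = .xa 0 := PresentedGroup.toGroup.of _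
  have ha := za_pow 9 4 8
  have hb := zb_pow 9 4 8
  have hab := za_mul_zb 9 4 8
  set A := za 9 4 8
  set B := zb 9 4 8
  have hA8 : A ^ 8 = A⁻¹ := eq_inv_of_mul_eq_one_left (by rw [← pow_succ, ha])
  rw [hA8] at hab
  have hinv : SemiconjBy B A⁻¹ A := hab.symm
  have hBA : SemiconjBy B A A⁻¹ := by simpa using hinv.inv_right
  have hcomm : Commute A (B ^ 2) := by
    rw [sq]
    exact (hinv.mul_left hBA).symm
  have hcomm' : Commute (A ^ 5) (B ^ 2) := hcomm.pow_left 5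
  have hpow (k : ℕ) : (A ^ 5 * B ^ 2) ^ k = A ^ (5 * k) * B ^ (2 * k) := by
    rw [hcomm'.mul_pow, ← pow_mul, ← pow_mul]
  have hB2 : (B ^ 2)⁻¹ = B ^ 2 := inv_eq_of_mul_eq_one_left (by rw [← pow_add, hb])
  have hA10 : A ^ 10 = A := by rw [pow_succ, ha, one_mul]
  have hC9 : (A ^ 5 * B ^ 2) ^ 9 = B * B := by
    rw [hpow, pow_mul' A, ha, one_pow, one_mul, show 2 * 9 = 4 * 4 + 2 by rfl, pow_add, pow_mul,
      hb, one_pow, one_mul, sq]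
  have hC18 : (A ^ 5 * B ^ 2) ^ (2 * 9) = 1 := by
    rw [pow_mul', hC9, ← sq, ← pow_mul, hb]
  have hBC : B * (A ^ 5 * B ^ 2) = (A ^ 5 * B ^ 2)⁻¹ * B := by
    have h : SemiconjBy B (A ^ 5 * B ^ 2) (A⁻¹ ^ 5 * B ^ 2) :=
      (hBA.pow_right 5).mul_right ((Commute.refl B).pow_right 2)
    rw [h.eq, hcomm'.eq, mul_inv_rev, hB2, inv_pow]
  let g : QuaternionGroup 9 →* ZM 9 4 8 :=
    QuaternionGroup.lift (A ^ 5 * B ^ 2) B hC18 hC9.symm hBC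
  have ga (k : ℕ) : g (.a k) = (A ^ 5 * B ^ 2) ^ k := QuaternionGroup.lift_a_natCast ..
  have gb : g (.xa 0) = B := QuaternionGroup.lift_xa_zero ..
  refine MonoidHom.toMulEquiv f g (PresentedGroup.ext fun x => ?_) (QuaternionGroup.hom_ext ?_ ?_)
  · fin_cases x
    · change g (f A) = A
      rw [fa]
      exact (ga 2).trans (by rw [hpow, hb, hA10, mul_one])
    · change g (f B) = B
      rw [fb, gb]
  · change f (g (.a 1)) = .a 1
    have ga1 : g (.a 1) = A ^ 5 * B ^ 2 := by simpa using ga 1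
    rw [ga1, map_mul, map_pow, map_pow, fa, fb]
    decide
  · change f (g (.xa 0)) = .xa 0
    rw [gb, fb]

/-- The factorization number of `ZM(9,4,8)` equals `85`. -/
theorem F2_ZM948 :
    Nat.card {p : Subgroup (ZM 9 4 8) × Subgroup (ZM 9 4 8) //
        (p.1 : Set (ZM 9 4 8)) * (p.2 : Set (ZM 9 4 8)) = Set.univ} = 85 := by
  rw [card_factorizations_congr ZM948EquivQuaternionGroup,
    QuaternionGroup.card_factorizations (by decide)]
  decide +kernel
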